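/- For every p > N, one has the two-sided bound N ω_N^{p/N} ((p−N)/(p−1))^{p−1} |Ω|^{1−p/N} ≤ Λ_p(Ω) ≤ N ω_N R_Ω^{N−p} ((p−N)/(p−1))^{p−1}, where R_Ω := sup_{x∈Ω} dist(x, Ωᶜ) is the inradius of Ω (the radius of the largest ball inscribed in Ω). -/

import Mathlib

open MeasureTheory Filter Topology Metric

noncomputable def LambdaP {N : ℕ} (Ω : Set (EuclideanSpace ℝ (Fin N))) (p : ℝ) : ℝ :=
  sInf { c : ℝ | ∃ u : EuclideanSpace ℝ (Fin N) → ℝ,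
    ContDiff ℝ (⊤ : ℕ∞) u ∧ HasCompactSupport u ∧ tsupport u ⊆ Ω ∧
    sSup ((fun x => |u x|) '' Ω) = 1 ∧
    c = ∫ x in Ω, ‖gradient u x‖ ^ p }

section

open scoped ENNReal

lemma polar_lint {N : ℕ} (hN : 2 ≤ N) (f : EuclideanSpace ℝ (Fin N) → ℝ≥0∞) (hf : Measurable f) :
    ∫⁻ x, f x = ∫⁻ θ : sphere (0 : EuclideanSpace ℝ (Fin N)) 1,
      (∫⁻ r in Set.Ioi (0:ℝ), ENNReal.ofReal (r ^ (N-1)) * f (r • (θ : EuclideanSpace ℝ (Fin N))))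
      ∂((volume : Measure (EuclideanSpace ℝ (Fin N))).toSphere) := by
  have : Nonempty (Fin N) := ⟨⟨0, by omega⟩⟩
  set μ := (volume : Measure (EuclideanSpace ℝ (Fin N)))
  calc ∫⁻ x, f x ∂μ = ∫⁻ x : ({(0)}ᶜ : Set (EuclideanSpace ℝ (Fin N))), f x ∂(μ.comap (↑)) := by
        rw [lintegral_subtype_comap (measurableSet_singleton _).compl, restrict_compl_singleton]
    _ = ∫⁻ x, f (x.2.1 • x.1.1) ∂μ.toSphere.prod (.volumeIoiPow (N - 1)) := by
        have h := μ.measurePreserving_homeomorphUnitSphereProd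
        rw [finrank_euclideanSpace_fin] at h
        rw [← h.lintegral_comp_emb (Homeomorph.measurableEmbedding _)]
        refine lintegral_congr fun x => ?_
        have : ((homeomorphUnitSphereProd (EuclideanSpace ℝ (Fin N))).symm
          (homeomorphUnitSphereProd (EuclideanSpace ℝ (Fin N)) x)) = x :=
            Homeomorph.symm_apply_apply _ _
        conv_lhs => rw [← this]
        rw [homeomorphUnitSphereProd_symm_apply_coe]
    _ = _ := by
        rw [lintegral_prod]
        · refine lintegral_congr fun θ => ?_
          simp only [Measure.volumeIoiPow]
          rw [lintegral_withDensity_eq_lintegral_mul]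
          · rw [← lintegral_subtype_comap measurableSet_Ioi]
            rfl
          · fun_prop
          · exact hf.comp (by fun_prop)
        · exact (hf.comp (by fun_prop)).aemeasurable

lemma radial_lint {N : ℕ} (hN : 2 ≤ N) (s R : ℝ) (hR : 0 < R) (hs : s < N) :
    ∫⁻ x in ball (0 : EuclideanSpace ℝ (Fin N)) R, ENNReal.ofReal (‖x‖ ^ (-s)) =
      ENNReal.ofReal (N * (volume (ball (0 : EuclideanSpace ℝ (Fin N)) 1)).toReal * 
        (R ^ ((N:ℝ) - s) / ((N:ℝ) - s))) := by
  have hfin : volume (ball (0 : EuclideanSpace ℝ (Fin N)) 1) ≠ ∞ := measure_ball_lt_top.ne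
  rw [← lintegral_indicator measurableSet_ball, polar_lint hN]
  swap
  · refine Measurable.indicator ?_ measurableSet_ball
    fun_prop
  have key : ∀ θ : sphere (0 : EuclideanSpace ℝ (Fin N)) 1,
      (∫⁻ r in Set.Ioi (0:ℝ), ENNReal.ofReal (r ^ (N-1)) * 
        (ball (0 : EuclideanSpace ℝ (Fin N)) R).indicator (fun x => ENNReal.ofReal (‖x‖ ^ (-s))) (r • (θ : EuclideanSpace ℝ (Fin N)))) = ENNReal.ofReal (R ^ ((N:ℝ) - s) / ((N:ℝ) - s)) := by
    intro θ
    have hθ : ‖(θ : EuclideanSpace ℝ (Fin N))‖ = 1 := by simpa using θ.2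
    have h1 : ∀ r ∈ Set.Ioi (0:ℝ), ENNReal.ofReal (r ^ (N-1)) * 
        (ball (0 : EuclideanSpace ℝ (Fin N)) R).indicator (fun x => ENNReal.ofReal (‖x‖ ^ (-s))) (r • (θ : EuclideanSpace ℝ (Fin N))) = (Set.Iio R).indicator (fun r => ENNReal.ofReal (r ^ ((N:ℝ) - s - 1))) r := by
      intro r hr
      have hr' : 0 < r := hr
      have hn : ‖r • (θ : EuclideanSpace ℝ (Fin N))‖ = r := by
        rw [norm_smul, hθ, mul_one, Real.norm_of_nonneg hr'.le]
      by_cases h : r < R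
      · rw [Set.indicator_of_mem (by simpa [hn] using h), Set.indicator_of_mem (by simpa using h), hn,
          ← ENNReal.ofReal_mul (by positivity), ← Real.rpow_natCast, ← Real.rpow_add hr']
        congr 2
        rw [Nat.cast_sub (by omega)]; push_cast; ring
      · rw [Set.indicator_of_notMem (by simpa [hn] using h), Set.indicator_of_notMem (by simpa using h), mul_zero]
    rw [setLIntegral_congr_fun measurableSet_Ioi h1, setLIntegral_indicator measurableSet_Iio,
      Set.inter_comm, Set.Ioi_inter_Iio, Measure.restrict_congr_set Ioo_ae_eq_Ioc,
      ← ofReal_integral_eq_lintegral_ofReal, ← intervalIntegral.integral_of_le hR.le, integral_rpow]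
    · rw [Real.zero_rpow (by linarith)]; congr 1; ring_nf
    · left; linarith
    · exact (intervalIntegral.intervalIntegrable_rpow' (by linarith)).1
    · filter_upwards [ae_restrict_mem measurableSet_Ioc] with y hy
      exact Real.rpow_nonneg hy.1.le _
  simp_rw [key]
  rw [lintegral_const, Measure.toSphere_apply_univ, finrank_euclideanSpace_fin, mul_comm,
    ENNReal.ofReal_mul (by positivity), ENNReal.ofReal_mul (by positivity),
    ENNReal.ofReal_toReal hfin, ENNReal.ofReal_natCast]

lemma repr_le {N : ℕ} (hN : 2 ≤ N) (u : EuclideanSpace ℝ (Fin N) → ℝ)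
    (hu : ContDiff ℝ (⊤ : ℕ∞) u) (hc : HasCompactSupport u) :
    N * volume (ball (0 : EuclideanSpace ℝ (Fin N)) 1) * ‖u 0‖ₑ ≤
      ∫⁻ x, ‖fderiv ℝ u x‖ₑ * ENNReal.ofReal (‖x‖ ^ (1 - (N:ℝ))) := by
  have hdc : Continuous (fderiv ℝ u) := hu.continuous_fderiv (by simp)
  rw [polar_lint hN _ (by have := hdc.measurable; fun_prop)]
  have key : ∀ θ : sphere (0 : EuclideanSpace ℝ (Fin N)) 1, ‖u 0‖ₑ ≤
      (∫⁻ r in Set.Ioi (0:ℝ), ENNReal.ofReal (r ^ (N-1)) * (‖fderiv ℝ u (r • (θ : EuclideanSpace ℝ (Fin N)))‖ₑ * ENNReal.ofReal (‖r • (θ : EuclideanSpace ℝ (Fin N))‖ ^ (1 - (N:ℝ))))) := by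
    intro θ
    have hθ : ‖(θ : EuclideanSpace ℝ (Fin N))‖ = 1 := by simpa using θ.2
    set g : ℝ → ℝ := fun t => u (t • (-(θ : EuclideanSpace ℝ (Fin N)))) with hg
    have hgd : ∀ t, HasDerivAt g (fderiv ℝ u (t • (-(θ : EuclideanSpace ℝ (Fin N)))) (-(θ : EuclideanSpace ℝ (Fin N)))) t := by
      intro t
      have := (hu.differentiable (by simp) (t • (-(θ : EuclideanSpace ℝ (Fin N))))).hasFDerivAt.comp_hasDerivAt t
        ((hasDerivAt_id t).smul_const (-(θ : EuclideanSpace ℝ (Fin N))))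
      simpa [hg, Function.comp_def] using this
    have hgc : HasCompactSupport g := by
      apply hc.comp_isClosedEmbedding
      exact (LinearMap.toSpanSingleton ℝ _ (-(θ : EuclideanSpace ℝ (Fin N)))).isClosedEmbedding_of_injective 
        (LinearMap.ker_toSpanSingleton ℝ (by intro h; rw [neg_eq_zero] at h; rw [h] at hθ; simp at hθ))
    have hg1 : ContDiff ℝ 1 g := (hu.of_le (by simp)).comp (by fun_prop)
    have h0 := hgc.enorm_le_lintegral_Ici_deriv hg1 0
    have hg0 : g 0 = u 0 := by simp [hg]
    rw [hg0] at h0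
    refine h0.trans ?_
    rw [← (Measure.measurePreserving_neg (volume : Measure ℝ)).setLIntegral_comp_preimage_emb (MeasurableEquiv.neg ℝ).measurableEmbedding]
    simp only [Set.neg_preimage, Set.neg_Iic, neg_zero]
    rw [Measure.restrict_congr_set Ioi_ae_eq_Ici.symm]
    refine setLIntegral_mono' measurableSet_Ioi fun r hr => ?_
    have hr' : 0 < r := hr
    have hn : ‖r • (θ : EuclideanSpace ℝ (Fin N))‖ = r := by
        rw [norm_smul, hθ, mul_one, Real.norm_of_nonneg hr'.le]
    rw [hn, mul_left_comm, ← ENNReal.ofReal_mul (by positivity), ← Real.rpow_natCast, ← Real.rpow_add hr', Nat.cast_sub (by omega)]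
    simp only [Nat.cast_one, sub_add_sub_cancel, sub_self, Real.rpow_zero, ENNReal.ofReal_one, mul_one]
    rw [(hgd _).deriv]
    simp only [smul_neg, neg_smul, neg_neg]
    refine (ContinuousLinearMap.le_opENorm _ _).trans ?_
    rw [enorm_neg, ← ofReal_norm, ← ofReal_norm, hθ]; simp
  calc _ = ∫⁻ θ : sphere (0 : EuclideanSpace ℝ (Fin N)) 1, ‖u 0‖ₑ ∂((volume : Measure (EuclideanSpace ℝ (Fin N))).toSphere) := by
        rw [lintegral_const, Measure.toSphere_apply_univ, finrank_euclideanSpace_fin, mul_comm]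
    _ ≤ _ := lintegral_mono key

lemma bathtub {N : ℕ} (hN : 2 ≤ N) (s R : ℝ) (hR : 0 < R) (hs : 0 ≤ s) 
    (A : Set (EuclideanSpace ℝ (Fin N))) (hA : MeasurableSet A) 
    (hv : volume A = volume (ball (0 : EuclideanSpace ℝ (Fin N)) R)) :
    ∫⁻ x in A, ENNReal.ofReal (‖x‖ ^ (-s)) ≤ 
    ∫⁻ x in ball (0 : EuclideanSpace ℝ (Fin N)) R, ENNReal.ofReal (‖x‖ ^ (-s)) := by
  have : Nonempty (Fin N) := ⟨⟨0, by omega⟩⟩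
  have hfin : volume (ball (0 : EuclideanSpace ℝ (Fin N)) R) ≠ ∞ := measure_ball_lt_top.ne
  set B := ball (0 : EuclideanSpace ℝ (Fin N)) R with hB
  have hBm : MeasurableSet B := measurableSet_ball
  rw [← lintegral_inter_add_sdiff _ A hBm, ← lintegral_inter_add_sdiff _ B hA, Set.inter_comm]
  gcongr ?_ + ?_
  · rfl
  have hvv : volume (A \ B) = volume (B \ A) := by
    have h1 := measure_inter_add_sdiff (μ := volume) A hBm
    have h2 := measure_inter_add_sdiff (μ := volume) B hA
    rw [hv, ← h2, Set.inter_comm] at h1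
    exact (ENNReal.add_right_inj (measure_ne_top_of_subset Set.inter_subset_left hfin)).1 h1
  calc ∫⁻ x in A \ B, ENNReal.ofReal (‖x‖ ^ (-s)) ≤ ∫⁻ x in A \ B, ENNReal.ofReal (R ^ (-s)) := by
        refine setLIntegral_mono' (hA.diff hBm) fun x hx => ENNReal.ofReal_le_ofReal ?_
        have : R ≤ ‖x‖ := by simpa [hB] using hx.2
        exact Real.rpow_le_rpow_of_nonpos hR this (by linarith)
    _ = ∫⁻ x in B \ A, ENNReal.ofReal (R ^ (-s)) := by simp [hvv]
    _ ≤ _ := by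
        refine lintegral_mono_ae ?_
        have h0 : ∀ᵐ x ∂(volume.restrict (B \ A)), x ≠ 0 := by
          apply ae_restrict_of_ae
          exact (measure_eq_zero_iff_ae_notMem (s := {(0 : EuclideanSpace ℝ (Fin N))})).1 (measure_singleton _)
        filter_upwards [h0, ae_restrict_mem (hBm.diff hA)] with x hx0 hx
        refine ENNReal.ofReal_le_ofReal ?_
        have : ‖x‖ < R := by simpa [hB] using hx.1
        exact Real.rpow_le_rpow_of_nonpos (norm_pos_iff.2 hx0) this.le (by linarith)

lemma norm_grad {N : ℕ} (u : EuclideanSpace ℝ (Fin N) → ℝ) (x : EuclideanSpace ℝ (Fin N)) :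
    ‖gradient u x‖ = ‖fderiv ℝ u x‖ := by
  unfold gradient
  exact LinearIsometryEquiv.norm_map _ _

lemma pointwise_le {N : ℕ} (hN : 2 ≤ N) (Ω : Set (EuclideanSpace ℝ (Fin N)))
    (hΩo : IsOpen Ω) (p : ℝ) (hp : (N : ℝ) < p) (R : ℝ) (hR : 0 < R)
    (hv : volume Ω = volume (ball (0 : EuclideanSpace ℝ (Fin N)) R))
    (u : EuclideanSpace ℝ (Fin N) → ℝ)
    (hu : ContDiff ℝ (⊤ : ℕ∞) u) (hc : HasCompactSupport u) (hs : tsupport u ⊆ Ω)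
    (x0 : EuclideanSpace ℝ (Fin N)) :
    N * (volume (ball (0 : EuclideanSpace ℝ (Fin N)) 1)).toReal * |u x0| ≤
      (∫ x in Ω, ‖gradient u x‖ ^ p) ^ (1 / p) *
      (N * (volume (ball (0 : EuclideanSpace ℝ (Fin N)) 1)).toReal *
        (R ^ ((p - N) / (p - 1)) / ((p - N) / (p - 1)))) ^ ((p - 1) / p) := by
  have hN' : (2:ℝ) ≤ N := by exact_mod_cast hN
  have hp1 : 0 < p - 1 := by linarith
  have hp0 : 0 < p := by linarith
  have hfin : volume (ball (0 : EuclideanSpace ℝ (Fin N)) 1) ≠ ∞ := measure_ball_lt_top.ne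
  have hdc : Continuous (fderiv ℝ u) := hu.continuous_fderiv (by simp)
  set q : ℝ := p / (p - 1) with hq
  set s : ℝ := (N - 1) * q with hsdef
  have ha : (N:ℝ) - s = (p - N) / (p - 1) := by
    rw [hsdef, hq]; field_simp; ring
  have hapos : 0 < (p - N) / (p - 1) := div_pos (by linarith) hp1
  have hpq : p.HolderConjugate q := by
    rw [hq]; exact Real.HolderConjugate.conjExponent (by linarith)
  set v : EuclideanSpace ℝ (Fin N) → ℝ := fun x => u (x0 + x) with hvdef
  have hv1 : ContDiff ℝ (⊤ : ℕ∞) v := hu.comp (by fun_prop)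
  have hv2 : HasCompactSupport v := hc.comp_homeomorph (Homeomorph.addLeft x0)
  have hfv : ∀ x, fderiv ℝ v x = fderiv ℝ u (x0 + x) := fun x => fderiv_comp_add_left x0
  have h1 := repr_le hN v hv1 hv2
  simp only [hfv] at h1
  set A : Set (EuclideanSpace ℝ (Fin N)) := (fun x => x0 + x) ⁻¹' Ω with hA
  have hAm : MeasurableSet A := (hΩo.preimage (by fun_prop)).measurableSet
  have hAv : volume A = volume (ball (0 : EuclideanSpace ℝ (Fin N)) R) := by
    rw [← hv, hA, measure_preimage_add]
  have hz : ∀ y, y ∉ Ω → fderiv ℝ u y = 0 := fun y hy => by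
    by_contra h
    exact hy (hs (support_fderiv_subset ℝ h))
  have h2 : ∫⁻ x, ‖fderiv ℝ u (x0 + x)‖ₑ * ENNReal.ofReal (‖x‖ ^ (1 - (N:ℝ))) =
      ∫⁻ x in A, ‖fderiv ℝ u (x0 + x)‖ₑ * ENNReal.ofReal (‖x‖ ^ (1 - (N:ℝ))) := by
    rw [← lintegral_indicator hAm]
    refine lintegral_congr fun x => ?_
    by_cases hx : x ∈ A
    · rw [Set.indicator_of_mem hx]
    · rw [Set.indicator_of_notMem hx, hz _ hx, ← ofReal_norm, norm_zero, ENNReal.ofReal_zero, zero_mul]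
  have h3 := ENNReal.lintegral_mul_le_Lp_mul_Lq (volume.restrict A) hpq
    (f := fun x => ‖fderiv ℝ u (x0 + x)‖ₑ) (g := fun x => ENNReal.ofReal (‖x‖ ^ (1 - (N:ℝ))))
    (by have : Continuous fun x => fderiv ℝ u (x0 + x) := hdc.comp (by fun_prop)
        exact this.enorm.measurable.aemeasurable) (by fun_prop)
  have h4 : ∫⁻ x in A, ENNReal.ofReal (‖x‖ ^ (1 - (N:ℝ))) ^ q ≤
      ENNReal.ofReal (N * (volume (ball (0 : EuclideanSpace ℝ (Fin N)) 1)).toReal *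
        (R ^ ((p - N) / (p - 1)) / ((p - N) / (p - 1)))) := by
    have h5 : ∀ x : EuclideanSpace ℝ (Fin N), ENNReal.ofReal (‖x‖ ^ (1 - (N:ℝ))) ^ q =
        ENNReal.ofReal (‖x‖ ^ (-s)) := fun x => by
      rw [ENNReal.ofReal_rpow_of_nonneg (by positivity) hpq.symm.nonneg, ← Real.rpow_mul (norm_nonneg _)]
      congr 2; rw [hsdef]; ring
    simp_rw [h5]
    refine (bathtub hN s R hR ?_ A hAm hAv).trans ?_
    · exact mul_nonneg (by linarith) hpq.symm.nonneg
    · rw [radial_lint hN s R hR (by linarith), ha]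
  have hpc : Continuous fun x => ‖fderiv ℝ u x‖ ^ p := hdc.norm.rpow_const (fun _ => Or.inr hp0.le)
  have h6 : ∫⁻ x in A, ‖fderiv ℝ u (x0 + x)‖ₑ ^ p = ENNReal.ofReal (∫ x in Ω, ‖gradient u x‖ ^ p) := by
    simp_rw [norm_grad]
    rw [ofReal_integral_eq_lintegral_ofReal]
    · have := (measurePreserving_add_left (volume : Measure (EuclideanSpace ℝ (Fin N))) x0).setLIntegral_comp_preimage_emb
        (Homeomorph.addLeft x0).measurableEmbedding (fun x => ENNReal.ofReal (‖fderiv ℝ u x‖ ^ p)) Ω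
      rw [← this]
      refine lintegral_congr fun x => ?_
      rw [← ofReal_norm, ENNReal.ofReal_rpow_of_nonneg (norm_nonneg _) hp0.le]
    · refine (hpc.integrable_of_hasCompactSupport ?_).integrableOn
      refine (hc.fderiv ℝ).comp_left (g := fun L => ‖L‖ ^ p) ?_
      simp [Real.zero_rpow hp0.ne']
    · exact Eventually.of_forall fun x => by positivity
  have hI : 0 ≤ ∫ x in Ω, ‖gradient u x‖ ^ p := integral_nonneg fun x => by positivity
  have hv0 : v 0 = u x0 := by simp [hvdef]
  have hJ : 0 ≤ N * (volume (ball (0 : EuclideanSpace ℝ (Fin N)) 1)).toReal *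
        (R ^ ((p - N) / (p - 1)) / ((p - N) / (p - 1))) := by positivity
  have h7 : N * volume (ball (0 : EuclideanSpace ℝ (Fin N)) 1) * ‖u x0‖ₑ ≤
      ENNReal.ofReal (∫ x in Ω, ‖gradient u x‖ ^ p) ^ (1 / p) *
      ENNReal.ofReal (N * (volume (ball (0 : EuclideanSpace ℝ (Fin N)) 1)).toReal *
        (R ^ ((p - N) / (p - 1)) / ((p - N) / (p - 1)))) ^ (1 / q) := by
    rw [hv0, h2] at h1
    refine (h1.trans h3).trans ?_
    rw [h6]
    gcongr
  have hq1 : 1 / q = (p - 1) / p := by rw [hq, one_div_div]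
  rw [hq1, ENNReal.ofReal_rpow_of_nonneg hI (by positivity), ENNReal.ofReal_rpow_of_nonneg hJ (by positivity),
    ← ENNReal.ofReal_mul (by positivity), ← ofReal_norm, ← ENNReal.ofReal_natCast,
    ← ENNReal.ofReal_toReal hfin, ← ENNReal.ofReal_mul (by positivity), ← ENNReal.ofReal_mul (by positivity),
    ENNReal.ofReal_le_ofReal_iff (by positivity)] at h7
  simpa using h7

lemma lower {N : ℕ} (hN : 2 ≤ N) (Ω : Set (EuclideanSpace ℝ (Fin N)))
    (hΩo : IsOpen Ω) (hΩb : Bornology.IsBounded Ω) (hΩne : Ω.Nonempty)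
    (p : ℝ) (hp : (N : ℝ) < p)
    (u : EuclideanSpace ℝ (Fin N) → ℝ)
    (hu : ContDiff ℝ (⊤ : ℕ∞) u) (hc : HasCompactSupport u) (hs : tsupport u ⊆ Ω)
    (h1 : sSup ((fun x => |u x|) '' Ω) = 1) :
    N * (volume (ball (0 : EuclideanSpace ℝ (Fin N)) 1)).toReal ^ (p / N) *
        ((p - N) / (p - 1)) ^ (p - 1) * (volume Ω).toReal ^ (1 - p / N) ≤
      ∫ x in Ω, ‖gradient u x‖ ^ p := by
  have : Nonempty (Fin N) := ⟨⟨0, by omega⟩⟩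
  have hN' : (2:ℝ) ≤ N := by exact_mod_cast hN
  have hp1 : 0 < p - 1 := by linarith
  have hp0 : 0 < p := by linarith
  have hfin : volume (ball (0 : EuclideanSpace ℝ (Fin N)) 1) ≠ ∞ := measure_ball_lt_top.ne
  have hV : 0 < (volume Ω).toReal := ENNReal.toReal_pos (hΩo.measure_pos volume hΩne).ne' hΩb.measure_lt_top.ne
  have hw : 0 < (volume (ball (0 : EuclideanSpace ℝ (Fin N)) 1)).toReal :=
    ENNReal.toReal_pos (measure_ball_pos _ _ one_pos).ne' hfin
  set w := (volume (ball (0 : EuclideanSpace ℝ (Fin N)) 1)).toReal with hwdef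
  set V := (volume Ω).toReal with hVdef
  have hapos : 0 < (p - N) / (p - 1) := div_pos (by linarith) hp1
  set a := (p - N) / (p - 1) with hadef
  set R : ℝ := (V / w) ^ (1 / (N:ℝ)) with hRdef
  have hR : 0 < R := by positivity
  have hRN : R ^ N = V / w := by
    rw [hRdef, ← Real.rpow_natCast, ← Real.rpow_mul (by positivity), one_div_mul_cancel (by positivity), Real.rpow_one]
  have hv : volume Ω = volume (ball (0 : EuclideanSpace ℝ (Fin N)) R) := by
    rw [Measure.addHaar_ball _ _ hR.le, finrank_euclideanSpace_fin, hRN,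
      ← ENNReal.ofReal_toReal hfin, ← ENNReal.ofReal_mul (by positivity), ← hwdef,
      div_mul_cancel₀ _ hw.ne', hVdef, ENNReal.ofReal_toReal hΩb.measure_lt_top.ne]
  have key := pointwise_le hN Ω hΩo p hp R hR hv u hu hc hs
  set I := ∫ x in Ω, ‖gradient u x‖ ^ p with hIdef
  rw [← hwdef, ← hadef] at key
  have hI : 0 ≤ I := integral_nonneg fun x => by positivity
  have h2 : N * w ≤ I ^ (1 / p) * (N * w * (R ^ a / a)) ^ ((p - 1) / p) := by
    have : sSup ((fun x => |u x|) '' Ω) ≤ I ^ (1 / p) * (N * w * (R ^ a / a)) ^ ((p - 1) / p) / (N * w) := by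
      refine csSup_le (hΩne.image _) ?_
      rintro _ ⟨x, -, rfl⟩
      rw [le_div_iff₀ (by positivity), mul_comm]
      exact key x
    rwa [h1, le_div_iff₀ (by positivity), one_mul] at this
  have h3 : (N * w) ^ p ≤ I * (N * w * (R ^ a / a)) ^ (p - 1) := by
    have := Real.rpow_le_rpow (by positivity) h2 hp0.le
    rwa [Real.mul_rpow (x := I ^ (1 / p)) (by positivity) (by positivity), ← Real.rpow_mul hI, ← Real.rpow_mul (by positivity),
      one_div_mul_cancel hp0.ne', div_mul_cancel₀ _ hp0.ne', Real.rpow_one] at this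
  rw [← div_le_iff₀ (by positivity)] at h3
  refine le_trans (le_of_eq ?_) h3
  have e1 : (R ^ a) ^ (p - 1) = (V / w) ^ (p / N - 1) := by
    rw [← Real.rpow_mul hR.le, hRdef, ← Real.rpow_mul (by positivity)]
    congr 1
    rw [hadef]; field_simp
  clear_value a
  rw [Real.mul_rpow (x := N * w) (y := R ^ a / a) (by positivity) (by positivity), Real.div_rpow (x := R ^ a) (by positivity) (by positivity), e1,
    Real.div_rpow hV.le hw.le, show 1 - p / N = - (p / N - 1) by ring, Real.rpow_neg hV.le,
    Real.rpow_sub_one hw.ne' (p / N)]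
  rw [Real.rpow_sub_one (x := N * w) (by positivity) p]
  field_simp

lemma exists_profile (a δ r r' : ℝ) (ha : 0 < a) (hδ : 0 < δ) (hδr : δ < r) (hr : r < r') :
    ∃ h : ℝ → ℝ, ContDiff ℝ (⊤ : ℕ∞) h ∧ (∀ t, 0 ≤ t → 0 ≤ h t) ∧ (∀ t, 0 < t → h t ≤ a * t ^ (a - 1)) ∧
      (∀ t, t ≤ δ / 2 → h t = 0) ∧ (∀ t, r' ≤ t → h t = 0) ∧
      r ^ a - δ ^ a ≤ ∫ t in (0:ℝ)..r', h t := by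
  set η := min (δ / 2) (r' - r) / 2 with hη
  have hηp : 0 < η := by
    have : 0 < r' - r := by linarith
    positivity
  have hη1 : 2 * η ≤ δ / 2 := by
    have := min_le_left (δ / 2) (r' - r); linarith
  have hη2 : 2 * η ≤ r' - r := by
    have := min_le_right (δ / 2) (r' - r); linarith
  let χ : ContDiffBump ((δ + r) / 2) := ⟨(r - δ) / 2, (r - δ) / 2 + η, by linarith, by linarith⟩
  have hz1 : ∀ t, t ≤ δ / 2 → χ t = 0 := fun t ht => by
    apply χ.zero_of_le_dist
    rw [Real.dist_eq, abs_sub_comm]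
    refine le_trans ?_ (le_abs_self _)
    change (r - δ) / 2 + η ≤ _
    linarith
  have hz2 : ∀ t, r' ≤ t → χ t = 0 := fun t ht => by
    apply χ.zero_of_le_dist
    rw [Real.dist_eq]
    refine le_trans ?_ (le_abs_self _)
    change (r - δ) / 2 + η ≤ _
    linarith
  have hone : ∀ t ∈ Set.Icc δ r, χ t = 1 := fun t ht => by
    apply χ.one_of_mem_closedBall
    rw [mem_closedBall, Real.dist_eq, abs_le]
    change -((r - δ) / 2) ≤ _ ∧ _ ≤ (r - δ) / 2
    constructor <;> linarith [ht.1, ht.2]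
  have hsm : ContDiff ℝ (⊤ : ℕ∞) (fun t => χ t * (a * t ^ (a - 1))) := by
    rw [contDiff_iff_contDiffAt]
    intro t
    by_cases ht : t < δ / 2
    · have : (fun t => χ t * (a * t ^ (a - 1))) =ᶠ[𝓝 t] fun _ => 0 := by
        filter_upwards [Iio_mem_nhds ht] with y hy
        rw [hz1 y (le_of_lt hy), zero_mul]
      exact contDiffAt_const.congr_of_eventuallyEq this
    · have h0 : t ≠ 0 := by intro h; apply ht; rw [h]; positivity
      exact χ.contDiff.contDiffAt.mul (contDiffAt_const.mul (Real.contDiffAt_rpow_const_of_ne h0))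
  have hnn : ∀ t, 0 ≤ t → 0 ≤ χ t * (a * t ^ (a - 1)) := fun t ht =>
    mul_nonneg χ.nonneg (by positivity)
  refine ⟨fun t => χ t * (a * t ^ (a - 1)), hsm, hnn, ?_, ?_, ?_, ?_⟩
  · intro t ht
    exact mul_le_of_le_one_left (by positivity) χ.le_one
  · intro t ht; simp only [hz1 t ht, zero_mul]
  · intro t ht; simp only [hz2 t ht, zero_mul]
  · have hint : ∀ x y : ℝ, IntervalIntegrable (fun t => χ t * (a * t ^ (a - 1))) volume x y := fun x y =>
      hsm.continuous.intervalIntegrable x y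
    have e : ∫ t in δ..r, χ t * (a * t ^ (a - 1)) = r ^ a - δ ^ a := by
      have : ∫ t in δ..r, χ t * (a * t ^ (a - 1)) = ∫ t in δ..r, a * t ^ (a - 1) := by
        apply intervalIntegral.integral_congr
        intro t ht
        rw [Set.uIcc_of_le hδr.le] at ht
        simp only [hone t ht, one_mul]
      rw [this, intervalIntegral.integral_const_mul, integral_rpow (Or.inl (by linarith))]
      rw [sub_add_cancel]; field_simp
    rw [← e]
    apply intervalIntegral.integral_mono_interval hδ.le hδr.le hr.le
    · filter_upwards [ae_restrict_mem measurableSet_Ioc] with y hy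
      exact hnn y hy.1.le
    · exact hint _ _

lemma test_fun {N : ℕ} (hN : 2 ≤ N) (Ω : Set (EuclideanSpace ℝ (Fin N)))
    (p : ℝ) (hp : (N : ℝ) < p) (δ r r' : ℝ) (hδ : 0 < δ) (hδr : δ < r) (hr : r < r')
    (x0 : EuclideanSpace ℝ (Fin N)) (hball : closedBall x0 r' ⊆ Ω) :
    ∃ u : EuclideanSpace ℝ (Fin N) → ℝ,
    ContDiff ℝ (⊤ : ℕ∞) u ∧ HasCompactSupport u ∧ tsupport u ⊆ Ω ∧
    sSup ((fun x => |u x|) '' Ω) = 1 ∧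
    ∫ x in Ω, ‖gradient u x‖ ^ p ≤ N * (volume (ball (0 : EuclideanSpace ℝ (Fin N)) 1)).toReal *
      ((r ^ ((p - N) / (p - 1)) - δ ^ ((p - N) / (p - 1))) ^ (-p) *
        (((p - N) / (p - 1)) ^ (p - 1) * r' ^ ((p - N) / (p - 1)))) := by
  have : Nonempty (Fin N) := ⟨⟨0, by omega⟩⟩
  have hN' : (2:ℝ) ≤ N := by exact_mod_cast hN
  have hp1 : 0 < p - 1 := by linarith
  have hp0 : 0 < p := by linarith
  have hapos : 0 < (p - N) / (p - 1) := div_pos (by linarith) hp1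
  have haeq : ((p - N) / (p - 1)) * (p - 1) = p - N := div_mul_cancel₀ _ hp1.ne'
  set a := (p - N) / (p - 1) with hadef
  clear_value a
  obtain ⟨h, hsm, hnn, hle, hz1, hz2, hC⟩ := exists_profile a δ r r' hapos hδ hδr hr
  set C := ∫ t in (0:ℝ)..r', h t with hCdef
  have hr0 : 0 < r := hδ.trans hδr
  have hr'0 : 0 < r' := hr0.trans hr
  have hd : 0 < r ^ a - δ ^ a := sub_pos.2 (Real.rpow_lt_rpow hδ.le hδr hapos)
  have hCp : 0 < C := hd.trans_le hC
  have hint : ∀ x y : ℝ, IntervalIntegrable h volume x y := fun x y => hsm.continuous.intervalIntegrable x y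
  set g : ℝ → ℝ := fun t => 1 - (∫ s in (0:ℝ)..t, h s) / C with hg
  have hgd : ∀ t, HasDerivAt g (-(h t / C)) t := fun t => by
    have := ((hsm.continuous.integral_hasStrictDerivAt 0 t).hasDerivAt.div_const C).const_sub 1
    exact this
  have hgs : ContDiff ℝ (⊤ : ℕ∞) g := by
    rw [contDiff_infty_iff_deriv]
    refine ⟨fun t => (hgd t).differentiableAt, ?_⟩
    have : deriv g = fun t => -(h t / C) := funext fun t => (hgd t).deriv
    rw [this]
    exact (hsm.div_const C).neg
  have hg1 : ∀ t, t ≤ δ / 2 → g t = 1 := by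
    intro t ht
    have : ∫ s in (0:ℝ)..t, h s = 0 := by
      apply intervalIntegral.integral_zero_ae
      refine Eventually.of_forall fun s hs => hz1 s ?_
      have := hs.2
      exact this.trans (max_le (by positivity) ht)
    simp [hg, this]
  have hg0 : ∀ t, r' ≤ t → g t = 0 := by
    intro t ht
    have : ∫ s in (0:ℝ)..t, h s = C := by
      rw [← intervalIntegral.integral_add_adjacent_intervals (hint 0 r') (hint r' t)]
      have : ∫ s in r'..t, h s = 0 := by
        apply intervalIntegral.integral_zero_ae
        refine Eventually.of_forall fun s hs => hz2 s ?_
        rw [Set.uIoc_of_le ht] at hs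
        exact hs.1.le
      rw [this, add_zero]
    simp [hg, this, hCp.ne']
  have hgle : ∀ t, 0 ≤ t → g t ≤ 1 := by
    intro t ht
    have : 0 ≤ ∫ s in (0:ℝ)..t, h s := intervalIntegral.integral_nonneg ht fun s hs => hnn s hs.1
    have : 0 ≤ (∫ s in (0:ℝ)..t, h s) / C := by positivity
    simp only [hg]; linarith
  have hgnn : ∀ t, 0 ≤ t → 0 ≤ g t := by
    intro t ht
    by_cases h' : r' ≤ t
    · rw [hg0 t h']
    · have h1 := intervalIntegral.integral_add_adjacent_intervals (hint 0 t) (hint t r')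
      have h2 : 0 ≤ ∫ s in t..r', h s := intervalIntegral.integral_nonneg (by linarith) fun s hs => hnn s (ht.trans hs.1)
      have : (∫ s in (0:ℝ)..t, h s) / C ≤ 1 := by
        rw [div_le_one hCp]; linarith
      simp only [hg]; linarith
  set u : EuclideanSpace ℝ (Fin N) → ℝ := fun x => g ‖x - x0‖ with hu
  have hloc : ∀ x, ‖x - x0‖ < δ / 2 → u =ᶠ[𝓝 x] fun _ => 1 := by
    intro x hx
    have : {y : EuclideanSpace ℝ (Fin N) | ‖y - x0‖ < δ / 2} ∈ 𝓝 x :=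
      (isOpen_lt (by fun_prop) (by fun_prop)).mem_nhds hx
    filter_upwards [this] with y hy
    exact hg1 _ (le_of_lt hy)
  have husm : ContDiff ℝ (⊤ : ℕ∞) u := by
    rw [contDiff_iff_contDiffAt]
    intro x
    by_cases hx : ‖x - x0‖ < δ / 2
    · exact contDiffAt_const.congr_of_eventuallyEq (hloc x hx)
    · have h0 : x - x0 ≠ 0 := by intro h; apply hx; rw [h]; simpa using hδ
      exact hgs.contDiffAt.comp x (ContDiffAt.norm ℝ (by fun_prop) h0)
  have hsupp : Function.support u ⊆ closedBall x0 r' := by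
    intro x hx
    by_contra h'
    rw [mem_closedBall, dist_eq_norm, not_le] at h'
    exact hx (hg0 _ h'.le)
  have hts : tsupport u ⊆ closedBall x0 r' := closure_minimal hsupp isClosed_closedBall
  have hcs : HasCompactSupport u := (isCompact_closedBall x0 r').of_isClosed_subset (isClosed_tsupport u) hts
  have hfd : ∀ x, ‖fderiv ℝ u x‖ ≤ h ‖x - x0‖ / C := by
    intro x
    by_cases hx : ‖x - x0‖ < δ / 2
    · rw [(hloc x hx).fderiv_eq]
      simp only [fderiv_fun_const, Pi.zero_apply, norm_zero]
      exact div_nonneg (hnn _ (norm_nonneg _)) hCp.le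
    · have h0 : x - x0 ≠ 0 := by intro h; apply hx; rw [h]; simpa using hδ
      have hn : DifferentiableAt ℝ (fun y : EuclideanSpace ℝ (Fin N) => ‖y - x0‖) x :=
        DifferentiableAt.norm ℝ (by fun_prop) h0
      have hcomp := (hgd ‖x - x0‖).comp_hasFDerivAt x hn.hasFDerivAt
      have : fderiv ℝ u x = _ := hcomp.fderiv
      rw [this, norm_smul, norm_neg, Real.norm_of_nonneg (div_nonneg (hnn _ (norm_nonneg _)) hCp.le)]
      refine mul_le_of_le_one_right (div_nonneg (hnn _ (norm_nonneg _)) hCp.le) ?_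
      have hl : LipschitzWith 1 (fun y : EuclideanSpace ℝ (Fin N) => ‖y - x0‖) := by
        apply LipschitzWith.of_dist_le_mul
        intro y z
        simpa [Real.dist_eq, dist_eq_norm] using abs_norm_sub_norm_le (y - x0) (z - x0)
      simpa using norm_fderiv_le_of_lipschitz ℝ hl
  refine ⟨u, husm, hcs, hts.trans hball, ?_, ?_⟩
  · apply IsGreatest.csSup_eq
    constructor
    · refine ⟨x0, hball (mem_closedBall_self hr'0.le), ?_⟩
      have : u x0 = 1 := by simpa [hu] using hg1 0 (by positivity)
      simp [this]
    · rintro _ ⟨x, -, rfl⟩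
      simp only [hu]
      rw [abs_of_nonneg (hgnn _ (norm_nonneg _))]
      exact hgle _ (norm_nonneg _)
  · set F : ℝ → ℝ := fun t => (h t / C) ^ p with hF
    have hFc : Continuous F := (hsm.continuous.div_const C).rpow_const fun _ => Or.inr hp0.le
    have hFi : Integrable (fun x : EuclideanSpace ℝ (Fin N) => F ‖x - x0‖) := by
      apply Continuous.integrable_of_hasCompactSupport
      · fun_prop
      · refine HasCompactSupport.intro (isCompact_closedBall x0 r') fun x hx => ?_
        rw [mem_closedBall, dist_eq_norm, not_le] at hx
        simp [hF, hz2 _ hx.le, Real.zero_rpow hp0.ne']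
    have hFnn : ∀ t, 0 ≤ t → 0 ≤ F t := fun t ht => Real.rpow_nonneg (div_nonneg (hnn t ht) hCp.le) _
    calc ∫ x in Ω, ‖gradient u x‖ ^ p ≤ ∫ x in Ω, F ‖x - x0‖ := by
          apply integral_mono_of_nonneg
          · exact Eventually.of_forall fun x => by positivity
          · exact hFi.integrableOn
          · refine Eventually.of_forall fun x => ?_
            simp only [norm_grad]
            exact Real.rpow_le_rpow (norm_nonneg _) (hfd x) hp0.le
      _ ≤ ∫ x, F ‖x - x0‖ := setIntegral_le_integral hFi (Eventually.of_forall fun x => hFnn _ (norm_nonneg _))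
      _ = ∫ x : EuclideanSpace ℝ (Fin N), F ‖x‖ := integral_sub_right_eq_self (fun x => F ‖x‖) x0
      _ = N * (volume (ball (0 : EuclideanSpace ℝ (Fin N)) 1)).toReal *
          ∫ y in Set.Ioi (0:ℝ), y ^ (N - 1) * F y := by
          rw [integral_fun_norm_addHaar, finrank_euclideanSpace_fin, nsmul_eq_mul, smul_eq_mul, ← mul_assoc]
          rfl
      _ ≤ _ := by
          gcongr
          have hri : IntervalIntegrable (fun t : ℝ => t ^ (a - 1)) volume 0 r' :=
            intervalIntegral.intervalIntegrable_rpow' (by linarith)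
          calc ∫ y in Set.Ioi (0:ℝ), y ^ (N - 1) * F y ≤
              ∫ y in Set.Ioi (0:ℝ), (Set.Iic r').indicator (fun y => C ^ (-p) * a ^ p * y ^ (a - 1)) y := by
                apply integral_mono_of_nonneg
                · filter_upwards [ae_restrict_mem measurableSet_Ioi] with y hy
                  exact mul_nonneg (pow_nonneg (le_of_lt hy) _) (hFnn y (le_of_lt hy))
                · rw [integrable_indicator_iff measurableSet_Iic, IntegrableOn,
                    Measure.restrict_restrict measurableSet_Iic, Set.inter_comm, Set.Ioi_inter_Iic]
                  exact hri.1.const_mul _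
                · filter_upwards [ae_restrict_mem measurableSet_Ioi] with y hy
                  have hy' : 0 < y := hy
                  by_cases hyr : y ≤ r'
                  · rw [Set.indicator_of_mem (by exact hyr)]
                    have : F y ≤ (a * y ^ (a - 1) / C) ^ p := by
                      apply Real.rpow_le_rpow (div_nonneg (hnn y hy'.le) hCp.le) _ hp0.le
                      have := hle y hy'
                      gcongr
                    refine (mul_le_mul_of_nonneg_left this (by positivity)).trans (le_of_eq ?_)
                    rw [Real.div_rpow (by positivity) hCp.le, Real.mul_rpow hapos.le (by positivity),
                      Real.rpow_neg hCp.le, ← Real.rpow_mul hy'.le, ← Real.rpow_natCast, Nat.cast_sub (by omega)]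
                    have e : y ^ (a - 1) = y ^ ((N:ℝ) - (1:ℕ)) * y ^ ((a - 1) * p) := by
                      rw [← Real.rpow_add hy']
                      congr 1
                      push_cast
                      linarith
                    rw [e]; ring
                  · rw [Set.indicator_of_notMem (by exact hyr)]
                    rw [hF]; simp only
                    rw [hz2 y (by linarith), zero_div, Real.zero_rpow hp0.ne', mul_zero]
            _ = C ^ (-p) * (a ^ (p - 1) * r' ^ a) := by
                rw [setIntegral_indicator measurableSet_Iic, Set.Ioi_inter_Iic,
                  ← intervalIntegral.integral_of_le hr'0.le, intervalIntegral.integral_const_mul,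
                  integral_rpow (Or.inl (by linarith)), sub_add_cancel, Real.zero_rpow hapos.ne',
                  Real.rpow_sub_one hapos.ne']
                field_simp
                ring
            _ ≤ _ := by
                gcongr ?_ * _
                exact Real.rpow_le_rpow_of_nonpos hd hC (by linarith)

end

theorem stmt6 {N : ℕ} (hN : 2 ≤ N) (Ω : Set (EuclideanSpace ℝ (Fin N)))
    (hΩo : IsOpen Ω) (hΩb : Bornology.IsBounded Ω) (hΩne : Ω.Nonempty)
    (p : ℝ) (hp : (N : ℝ) < p) :
    N * (volume (ball (0 : EuclideanSpace ℝ (Fin N)) 1)).toReal ^ (p / N) *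
        ((p - N) / (p - 1)) ^ (p - 1) * (volume Ω).toReal ^ (1 - p / N) ≤
      LambdaP Ω p ∧
    LambdaP Ω p ≤
      N * (volume (ball (0 : EuclideanSpace ℝ (Fin N)) 1)).toReal *
        (sSup ((fun x => infDist x Ωᶜ) '' Ω)) ^ ((N : ℝ) - p) *
        ((p - N) / (p - 1)) ^ (p - 1) := by
  have : Nonempty (Fin N) := ⟨⟨0, by omega⟩⟩
  have hN' : (2:ℝ) ≤ N := by exact_mod_cast hN
  have hp1 : 0 < p - 1 := by linarith
  have hp0 : 0 < p := by linarith
  have hapos : 0 < (p - N) / (p - 1) := div_pos (by linarith) hp1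
  have hcne : (Ωᶜ).Nonempty := by
    rw [Set.nonempty_compl]
    intro h
    rw [h] at hΩb
    exact NormedSpace.unbounded_univ ℝ (EuclideanSpace ℝ (Fin N)) hΩb
  have hbdd : BddAbove ((fun x => infDist x Ωᶜ) '' Ω) := by
    obtain ⟨y, hy⟩ := hcne
    obtain ⟨M, hM⟩ := hΩb.subset_closedBall y
    refine ⟨M, ?_⟩
    rintro _ ⟨x, hx, rfl⟩
    exact (infDist_le_dist_of_mem hy).trans (hM hx)
  set R := sSup ((fun x => infDist x Ωᶜ) '' Ω) with hRdef
  have hR : 0 < R := by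
    obtain ⟨x, hx⟩ := hΩne
    have h1 : 0 < infDist x Ωᶜ :=
      (hΩo.isClosed_compl.notMem_iff_infDist_pos hcne).1 (fun h => h hx)
    exact h1.trans_le (le_csSup hbdd ⟨x, hx, rfl⟩)
  have hex : ∀ δ r, 0 < δ → δ < r → r < R → ∃ u : EuclideanSpace ℝ (Fin N) → ℝ,
      ContDiff ℝ (⊤ : ℕ∞) u ∧ HasCompactSupport u ∧ tsupport u ⊆ Ω ∧
      sSup ((fun x => |u x|) '' Ω) = 1 ∧
      ∫ x in Ω, ‖gradient u x‖ ^ p ≤ N * (volume (ball (0 : EuclideanSpace ℝ (Fin N)) 1)).toReal *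
        ((r ^ ((p - N) / (p - 1)) - δ ^ ((p - N) / (p - 1))) ^ (-p) *
          (((p - N) / (p - 1)) ^ (p - 1) * R ^ ((p - N) / (p - 1)))) := by
    intro δ r hδ hδr hr
    obtain ⟨_, ⟨x, hx, rfl⟩, hxr⟩ := exists_lt_of_lt_csSup (hΩne.image _) hr
    simp only at hxr
    obtain ⟨r', h1, h2⟩ := exists_between hxr
    have hb : closedBall x r' ⊆ Ω := by
      intro y hy
      by_contra hyΩ
      have := infDist_le_dist_of_mem (x := x) (show y ∈ Ωᶜ from hyΩ)
      rw [mem_closedBall, dist_comm] at hy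
      linarith
    obtain ⟨u, hu1, hu2, hu3, hu4, hu5⟩ := test_fun hN Ω p hp δ r r' hδ hδr h1 x hb
    refine ⟨u, hu1, hu2, hu3, hu4, hu5.trans ?_⟩
    have hR' : r' ≤ R := h2.le.trans (le_csSup hbdd ⟨x, hx, rfl⟩)
    have hr'0 : 0 ≤ r' := by linarith
    have hd : 0 ≤ r ^ ((p - N) / (p - 1)) - δ ^ ((p - N) / (p - 1)) :=
      sub_nonneg.2 (Real.rpow_le_rpow hδ.le hδr.le hapos.le)
    gcongr
  have hbelow : BddBelow { c : ℝ | ∃ u : EuclideanSpace ℝ (Fin N) → ℝ,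
    ContDiff ℝ (⊤ : ℕ∞) u ∧ HasCompactSupport u ∧ tsupport u ⊆ Ω ∧
    sSup ((fun x => |u x|) '' Ω) = 1 ∧
    c = ∫ x in Ω, ‖gradient u x‖ ^ p } := by
    refine ⟨0, ?_⟩
    rintro _ ⟨u, -, -, -, -, rfl⟩
    exact integral_nonneg fun x => by positivity
  constructor
  · apply le_csInf
    · obtain ⟨u, h1, h2, h3, h4, -⟩ := hex (R / 3) (R / 2) (by linarith) (by linarith) (by linarith)
      exact ⟨_, u, h1, h2, h3, h4, rfl⟩
    · rintro _ ⟨u, h1, h2, h3, h4, rfl⟩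
      exact lower hN Ω hΩo hΩb hΩne p hp u h1 h2 h3 h4
  · have haeq : ((p - N) / (p - 1)) * (p - 1) = p - N := div_mul_cancel₀ _ hp1.ne'
    set a := (p - N) / (p - 1) with hadef
    clear_value a
    have hup : ∀ t, 0 < t → t < R / 2 → LambdaP Ω p ≤
        N * (volume (ball (0 : EuclideanSpace ℝ (Fin N)) 1)).toReal *
        (((R - t) ^ a - t ^ a) ^ (-p) * (a ^ (p - 1) * R ^ a)) := by
      intro t ht0 ht
      obtain ⟨u, h1, h2, h3, h4, h5⟩ := hex t (R - t) ht0 (by linarith) (by linarith)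
      exact (csInf_le hbelow ⟨u, h1, h2, h3, h4, rfl⟩).trans h5
    have hc : ContinuousAt (fun t : ℝ => N * (volume (ball (0 : EuclideanSpace ℝ (Fin N)) 1)).toReal *
        (((R - t) ^ a - t ^ a) ^ (-p) * (a ^ (p - 1) * R ^ a))) 0 := by
      refine continuousAt_const.mul (ContinuousAt.mul ?_ continuousAt_const)
      refine ContinuousAt.rpow_const ?_ ?_
      · exact (ContinuousAt.rpow_const (by fun_prop) (Or.inr hapos.le)).sub
          (ContinuousAt.rpow_const (by fun_prop) (Or.inr hapos.le))
      · left
        rw [sub_zero, Real.zero_rpow hapos.ne', sub_zero]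
        positivity
    have hlim := hc.tendsto.mono_left (nhdsWithin_le_nhds (s := Set.Ioi 0))
    have := ge_of_tendsto hlim (b := LambdaP Ω p) (by
      filter_upwards [Ioo_mem_nhdsGT (show (0:ℝ) < R / 2 by positivity)] with t ht
      exact hup t ht.1 ht.2)
    refine this.trans (le_of_eq ?_)
    rw [sub_zero, Real.zero_rpow hapos.ne', sub_zero, ← Real.rpow_mul hR.le]
    have e : R ^ ((N:ℝ) - p) = R ^ (a * -p) * R ^ a := by
      rw [← Real.rpow_add hR]; congr 1; linarith
    rw [e]; ring
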